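/- For every empirical model e on a measurement scenario (X, M, O), the maximum incompatibility of marginals is bounded above by the signalling fraction: MIM(e) ≤ SF(e). -/

import Mathlib

/-- Joint outcome assignments for the measurements in `U`. -/
abbrev Assign {X : Type} (O : X → Type) (U : Finset X) : Type :=
  (x : {x : X // x ∈ U}) → O x.1

/-- Marginalisation of a (sub)distribution on `O_U` to `O_V` for `V ⊆ U`. -/
noncomputable def marginal {X : Type} [DecidableEq X] {O : X → Type}
    [∀ x, Fintype (O x)] [∀ x, DecidableEq (O x)]
    {U V : Finset X} (h : V ⊆ U) (d : Assign O U → ℝ) : Assign O V → ℝ :=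
  fun t => ∑ s : Assign O U,
    if (fun x : {x : X // x ∈ V} => s ⟨x.1, h x.2⟩) = t then d s else 0

/-- A model on the scenario with contexts `M`: a real-valued table for each context. -/
abbrev Model {X : Type} (O : X → Type) (M : Finset (Finset X)) : Type :=
  (C : {C : Finset X // C ∈ M}) → Assign O C.1 → ℝ

/-- `M` is a covering family of contexts for `X`. -/
def Covers {X : Type} (M : Finset (Finset X)) : Prop :=
  ∀ x : X, ∃ C ∈ M, x ∈ C

/-- An empirical model: each context carries a probability distribution. -/
def IsEmpirical {X : Type} [DecidableEq X] {O : X → Type} [∀ x, Fintype (O x)]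
    {M : Finset (Finset X)} (e : Model O M) : Prop :=
  ∀ C, (∀ s, 0 ≤ e C s) ∧ (∑ s, e C s) = 1

/-- Non-signalling: marginals agree on intersections of contexts. -/
def NonSignalling {X : Type} [DecidableEq X] {O : X → Type}
    [∀ x, Fintype (O x)] [∀ x, DecidableEq (O x)]
    {M : Finset (Finset X)} (e : Model O M) : Prop :=
  ∀ C C' : {C : Finset X // C ∈ M},
    marginal (Finset.inter_subset_left : C.1 ∩ C'.1 ⊆ C.1) (e C) =
      marginal (Finset.inter_subset_right : C.1 ∩ C'.1 ⊆ C'.1) (e C')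

/-- Deterministic: each context carries a Dirac (point-mass) distribution. -/
def Deterministic {X : Type} [DecidableEq X] {O : X → Type} [∀ x, DecidableEq (O x)]
    {M : Finset (Finset X)} (e : Model O M) : Prop :=
  ∀ C, ∃ s₀ : Assign O C.1, ∀ s, e C s = if s = s₀ then 1 else 0

/-- Marginal of a function on global assignments to the context `C`. -/
noncomputable def globMarg {X : Type} [Fintype X] [DecidableEq X] (O : X → Type)
    [∀ x, Fintype (O x)] [∀ x, DecidableEq (O x)]
    (C : Finset X) (b : (∀ x, O x) → ℝ) : Assign O C → ℝ :=
  fun t => ∑ g : ∀ x, O x,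
    if (fun x : {x : X // x ∈ C} => g x.1) = t then b g else 0

/-- The noncontextual fraction. -/
noncomputable def NCF {X : Type} [Fintype X] [DecidableEq X] {O : X → Type}
    [∀ x, Fintype (O x)] [∀ x, DecidableEq (O x)]
    {M : Finset (Finset X)} (e : Model O M) : ℝ :=
  sSup { r | ∃ b : (∀ x, O x) → ℝ, (∀ g, 0 ≤ b g) ∧
    (∀ C : {C : Finset X // C ∈ M}, ∀ t, globMarg O C.1 b t ≤ e C t) ∧
    r = ∑ g, b g }

/-- The contextual fraction. -/
noncomputable def CF {X : Type} [Fintype X] [DecidableEq X] {O : X → Type}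
    [∀ x, Fintype (O x)] [∀ x, DecidableEq (O x)]
    {M : Finset (Finset X)} (e : Model O M) : ℝ :=
  1 - NCF e

/-- The non-signalling fraction. -/
noncomputable def NSF {X : Type} [Fintype X] [DecidableEq X] {O : X → Type}
    [∀ x, Fintype (O x)] [∀ x, DecidableEq (O x)]
    {M : Finset (Finset X)} (e : Model O M) : ℝ :=
  sSup { r | ∃ b : (∀ x, O x) → ℝ,
    (∀ C : {C : Finset X // C ∈ M}, ∀ t,
      0 ≤ globMarg O C.1 b t ∧ globMarg O C.1 b t ≤ e C t) ∧
    r = ∑ g, b g }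

/-- The signalling fraction. -/
noncomputable def SF {X : Type} [Fintype X] [DecidableEq X] {O : X → Type}
    [∀ x, Fintype (O x)] [∀ x, DecidableEq (O x)]
    {M : Finset (Finset X)} (e : Model O M) : ℝ :=
  1 - NSF e

/-- The maximum incompatibility of marginals. -/
noncomputable def MIM {X : Type} [DecidableEq X] {O : X → Type}
    [∀ x, Fintype (O x)] [∀ x, DecidableEq (O x)]
    {M : Finset (Finset X)} (e : Model O M) : ℝ :=
  sSup { r | ∃ C C' : {C : Finset X // C ∈ M}, C.1 ≠ C'.1 ∧
    ∃ t : Assign O (C.1 ∩ C'.1),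
      r = |marginal (Finset.inter_subset_left : C.1 ∩ C'.1 ⊆ C.1) (e C) t -
            marginal (Finset.inter_subset_right : C.1 ∩ C'.1 ⊆ C'.1) (e C') t| }

/-- The generalised total variation distance between two models. -/
noncomputable def tvDist {X : Type} [DecidableEq X] {O : X → Type}
    [∀ x, Fintype (O x)]
    {M : Finset (Finset X)} (e e' : Model O M) : ℝ :=
  sSup { r | ∃ C : {C : Finset X // C ∈ M}, r = (1/2) * ∑ s, |e C s - e' C s| }

section

variable {X : Type} [DecidableEq X] {O : X → Type}
  [∀ x, Fintype (O x)] [∀ x, DecidableEq (O x)]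

theorem marginal_sub {U V : Finset X} (h : V ⊆ U) (d d' : Assign O U → ℝ) (t : Assign O V) :
    marginal h (fun s => d s - d' s) t = marginal h d t - marginal h d' t := by
  simp only [marginal, ← Finset.sum_sub_distrib]
  refine Finset.sum_congr rfl fun s _ => ?_
  split_ifs <;> simp

theorem marginal_nonneg {U V : Finset X} (h : V ⊆ U) {d : Assign O U → ℝ}
    (hd : ∀ s, 0 ≤ d s) (t : Assign O V) : 0 ≤ marginal h d t :=
  Finset.sum_nonneg fun s _ => by split_ifs <;> simp [hd]

theorem marginal_le_sum {U V : Finset X} (h : V ⊆ U) {d : Assign O U → ℝ}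
    (hd : ∀ s, 0 ≤ d s) (t : Assign O V) : marginal h d t ≤ ∑ s, d s :=
  Finset.sum_le_sum fun s _ => by split_ifs <;> simp [hd]

variable [Fintype X]

theorem sum_globMarg (C : Finset X) (b : (∀ x, O x) → ℝ) :
    ∑ t, globMarg O C b t = ∑ g, b g := by
  unfold globMarg
  rw [Finset.sum_comm]
  simp

theorem marginal_globMarg {U V : Finset X} (h : V ⊆ U) (b : (∀ x, O x) → ℝ) :
    marginal h (globMarg O U b) = globMarg O V b := by
  funext t
  have push (s : Assign O U) :
      (if (fun x : {x : X // x ∈ V} => s ⟨x.1, h x.2⟩) = t then globMarg O U b s else 0) =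
        ∑ g : ∀ x, O x, if (fun x : {x : X // x ∈ U} => g x.1) = s then
          (if (fun x : {x : X // x ∈ V} => g x.1) = t then b g else 0) else 0 := by
    split_ifs with hs
    · refine Finset.sum_congr rfl fun g _ => ?_
      by_cases hg : (fun x : {x : X // x ∈ U} => g x.1) = s
      · subst hg
        simp [hs]
      · simp [hg]
    · refine (Finset.sum_eq_zero fun g _ => ?_).symm
      by_cases hg : (fun x : {x : X // x ∈ U} => g x.1) = s
      · subst hg
        simp [hs]
      · simp [hg]
  simp only [marginal, push]
  rw [Finset.sum_comm]
  simp [globMarg]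

/-- If the marginal of `b` lies below a table `d`, then further marginals of the two differ by at
most the difference of their total masses. -/
theorem marginal_sub_globMarg_mem_Icc {U V : Finset X} (h : V ⊆ U) {d : Assign O U → ℝ}
    {b : (∀ x, O x) → ℝ} (hb : ∀ s, globMarg O U b s ≤ d s) (t : Assign O V) :
    marginal h d t - globMarg O V b t ∈ Set.Icc 0 (∑ s, d s - ∑ g, b g) := by
  have hd : ∀ s, 0 ≤ d s - globMarg O U b s := fun s => sub_nonneg.2 (hb s)
  rw [← marginal_globMarg h, ← marginal_sub, ← sum_globMarg U b, ← Finset.sum_sub_distrib]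
  exact ⟨marginal_nonneg h hd t, marginal_le_sum h hd t⟩

end

theorem MIM_le_SF {X : Type} [Fintype X] [DecidableEq X] {O : X → Type}
    [∀ x, Fintype (O x)] [∀ x, DecidableEq (O x)] [∀ x, Nonempty (O x)]
    {M : Finset (Finset X)} (hM : Covers M)
    (e : Model O M) (he : IsEmpirical e) :
    MIM e ≤ SF e := by
  have feasible_zero (C : {C : Finset X // C ∈ M}) (t : Assign O C.1) :
      0 ≤ globMarg O C.1 0 t ∧ globMarg O C.1 0 t ≤ e C t := by
    simp [globMarg, (he C).1 t]
  have NSF_le_one : NSF e ≤ 1 := by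
    rcases M.eq_empty_or_nonempty with rfl | ⟨C, hC⟩
    · have : IsEmpty X := ⟨fun x => by simpa using hM x⟩
      have huniv : { r | ∃ b : (∀ x, O x) → ℝ,
          (∀ C : {C : Finset X // C ∈ (∅ : Finset (Finset X))}, ∀ t,
            0 ≤ globMarg O C.1 b t ∧ globMarg O C.1 b t ≤ e C t) ∧
          r = ∑ g, b g } = Set.univ :=
        Set.eq_univ_of_forall fun r =>
          ⟨fun _ => r, fun C => absurd C.2 (Finset.notMem_empty _), by simp⟩
      rw [NSF, huniv, Real.sSup_univ]
      exact zero_le_one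
    · refine Real.sSup_le ?_ zero_le_one
      rintro _ ⟨b, hb, rfl⟩
      rw [← (he ⟨C, hC⟩).2, ← sum_globMarg C b]
      exact Finset.sum_le_sum fun t _ => (hb ⟨C, hC⟩ t).2
  refine Real.sSup_le ?_ (sub_nonneg.2 NSF_le_one)
  rintro _ ⟨C, C', -, t, rfl⟩
  have gap (b : (∀ x, O x) → ℝ)
      (hb : ∀ C : {C : Finset X // C ∈ M}, ∀ t,
        0 ≤ globMarg O C.1 b t ∧ globMarg O C.1 b t ≤ e C t) :
      |marginal (Finset.inter_subset_left : C.1 ∩ C'.1 ⊆ C.1) (e C) t -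
        marginal (Finset.inter_subset_right : C.1 ∩ C'.1 ⊆ C'.1) (e C') t| ≤ 1 - ∑ g, b g := by
    have hC := marginal_sub_globMarg_mem_Icc
      (Finset.inter_subset_left : C.1 ∩ C'.1 ⊆ C.1) (fun s => (hb C s).2) t
    have hC' := marginal_sub_globMarg_mem_Icc
      (Finset.inter_subset_right : C.1 ∩ C'.1 ⊆ C'.1) (fun s => (hb C' s).2) t
    rw [(he _).2, Set.mem_Icc] at hC hC'
    rw [abs_le]
    constructor <;> linarith
  refine le_sub_comm.1 (Real.sSup_le ?_ ?_)
  · rintro _ ⟨b, hb, rfl⟩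
    exact le_sub_comm.1 (gap b hb)
  · simpa using gap 0 feasible_zero
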